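/- arXiv:2012.01040 — 5 statements merged into one kernel-verified Lean document; each statement's English description precedes it below -/
import Mathlib

section
/- Let μ₁,…,μ_m, λ₁,…,λ_m ∈ ℂ satisfy μᵢ ≠ λⱼ for all i,j, and let v ∈ ℂ^m, w ∈ ℂ^m be data vectors. Then the shifted Loewner matrix satisfies the Sylvester equation M·𝕃ₛ − 𝕃ₛ·Λ = (M·v)·𝟙ᵀ − 𝟙·(Λ·w)ᵀ, where M = diag(μ₁,…,μ_m), Λ = diag(λ₁,…,λ_m) and 𝟙 ∈ ℂ^m is the all-ones vector. -/
/-- The shifted Loewner matrix satisfies the Sylvester equation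
`M·𝕃ₛ − 𝕃ₛ·Λ = (M·v)·𝟙ᵀ − 𝟙·(Λ·w)ᵀ` with `M = diag(μ)`, `Λ = diag(λ)`. -/
theorem shifted_loewner_sylvester
    (m : ℕ) (μ lam v w : Fin m → ℂ) (h : ∀ i j, μ i ≠ lam j)
    (Ls : Matrix (Fin m) (Fin m) ℂ)
    (hLs : ∀ i j, Ls i j = (μ i * v i - lam j * w j) / (μ i - lam j)) :
    Matrix.diagonal μ * Ls - Ls * Matrix.diagonal lam
      = Matrix.vecMulVec (fun i => μ i * v i) (fun _ => 1)
          - Matrix.vecMulVec (fun _ => 1) (fun j => lam j * w j) := by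
  ext i j
  have hij : μ i - lam j ≠ 0 := sub_ne_zero.mpr (h i j)
  simp only [Matrix.sub_apply, Matrix.diagonal_mul, Matrix.mul_diagonal, Matrix.vecMulVec_apply,
    hLs, mul_one, one_mul]
  field_simp
end

section
/- Let μ₁,…,μ_m, λ₁,…,λ_m ∈ ℂ satisfy μᵢ ≠ λⱼ for all i,j, let v, w ∈ ℂ^m, and set E = −𝕃, A = −𝕃ₛ, B = v ∈ ℂ^m and C ∈ ℂ^{1×m} with entries Cⱼ = wⱼ. Fix an index j and suppose the matrix λⱼE − A is invertible. Then the Loewner descriptor model interpolates the data at λⱼ: C · (λⱼE − A)^{−1} · B = wⱼ. -/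
open Matrix

/-- The Loewner descriptor model `(E, A, B, C) = (−𝕃, −𝕃ₛ, v, wᵀ)`
interpolates the data at the point `λⱼ`: `C(λⱼE − A)⁻¹B = wⱼ`, provided
`λⱼE − A` is invertible. -/
theorem loewner_descriptor_interpolates_at_lambda
    (m : ℕ) (μ lam v w : Fin m → ℂ) (h : ∀ i j, μ i ≠ lam j)
    (L Ls : Matrix (Fin m) (Fin m) ℂ)
    (hL : ∀ i j, L i j = (v i - w j) / (μ i - lam j))
    (hLs : ∀ i j, Ls i j = (μ i * v i - lam j * w j) / (μ i - lam j))
    (E A : Matrix (Fin m) (Fin m) ℂ) (hE : E = -L) (hA : A = -Ls)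
    (j : Fin m) (hinv : IsUnit (lam j • E - A)) :
    w ⬝ᵥ ((lam j • E - A)⁻¹ *ᵥ v) = w j := by
  have hcol : (lam j • E - A) *ᵥ Pi.single j 1 = v := by
    ext i
    have hij : μ i - lam j ≠ 0 := sub_ne_zero.mpr (h i j)
    simp only [mulVec_single_one, col_apply, hE, hA, Matrix.sub_apply, Matrix.smul_apply,
      Matrix.neg_apply, hL, hLs, smul_eq_mul]
    field_simp
    ring
  have hdet := (isUnit_iff_isUnit_det _).mp hinv
  have hsol : (lam j • E - A)⁻¹ *ᵥ v = Pi.single j 1 := by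
    conv_lhs => rw [← hcol]
    rw [mulVec_mulVec, nonsing_inv_mul _ hdet, one_mulVec]
  rw [hsol, dotProduct_single_one]
end

section
/- Let μ₁,…,μ_m, λ₁,…,λ_m ∈ ℂ satisfy μᵢ ≠ λⱼ for all i,j, let v, w ∈ ℂ^m, and set E = −𝕃, A = −𝕃ₛ, B = v ∈ ℂ^m and C ∈ ℂ^{1×m} with entries Cⱼ = wⱼ. Fix an index i and suppose the matrix μᵢE − A is invertible. Then the Loewner descriptor model interpolates the data at μᵢ: C · (μᵢE − A)^{−1} · B = vᵢ. -/
open Matrix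

/-- The Loewner descriptor model `(E, A, B, C) = (−𝕃, −𝕃ₛ, v, wᵀ)`
interpolates the data at the point `μᵢ`: `C(μᵢE − A)⁻¹B = vᵢ`, provided
`μᵢE − A` is invertible. -/
theorem loewner_descriptor_interpolates_at_mu
    (m : ℕ) (μ lam v w : Fin m → ℂ) (h : ∀ i j, μ i ≠ lam j)
    (L Ls : Matrix (Fin m) (Fin m) ℂ)
    (hL : ∀ i j, L i j = (v i - w j) / (μ i - lam j))
    (hLs : ∀ i j, Ls i j = (μ i * v i - lam j * w j) / (μ i - lam j))
    (E A : Matrix (Fin m) (Fin m) ℂ) (hE : E = -L) (hA : A = -Ls)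
    (i : Fin m) (hinv : IsUnit (μ i • E - A)) :
    w ⬝ᵥ ((μ i • E - A)⁻¹ *ᵥ v) = v i := by
  have hrow : w = (μ i • E - A) i := by
    ext j
    have hne := sub_ne_zero.mpr (h i j)
    simp only [hE, hA, Matrix.sub_apply, Matrix.smul_apply, Matrix.neg_apply, hL, hLs,
      smul_eq_mul]
    field_simp
    ring
  calc w ⬝ᵥ ((μ i • E - A)⁻¹ *ᵥ v)
      = (μ i • E - A) i ⬝ᵥ ((μ i • E - A)⁻¹ *ᵥ v) := congrArg (· ⬝ᵥ _) hrow
    _ = ((μ i • E - A) *ᵥ ((μ i • E - A)⁻¹ *ᵥ v)) i := rfl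
    _ = v i := by
      rw [Matrix.mulVec_mulVec,
        Matrix.mul_nonsing_inv _ ((Matrix.isUnit_iff_isUnit_det _).mp hinv), Matrix.one_mulVec]
end

section
/- Let H(s) = Σ_{k=1}^n c_k/(s − p_k) be a rational function with complex residues c_k and distinct poles p_k, and let μ₁,…,μ_m, λ₁,…,λ_m ∈ ℂ be points with μᵢ ≠ λⱼ for all i,j and with no μᵢ or λⱼ equal to any pole p_k. Let 𝕃 be the Loewner matrix built from the data vᵢ = H(μᵢ) and wⱼ = H(λⱼ). Then [𝕃]_{ij} = −Σ_{k=1}^n c_k /((μᵢ − p_k)(λⱼ − p_k)) for all i,j, and consequently the rank of 𝕃 is at most n. -/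
/-- The Loewner matrix built from samples of the rational function
`H(s) = Σₖ cₖ/(s − pₖ)` (with distinct poles, none of which is a sample
point) admits the factorized form
`[𝕃]_{ij} = −Σₖ cₖ/((μᵢ − pₖ)(λⱼ − pₖ))`, hence has rank at most `n`. -/
theorem loewner_rank_of_rational
    (n m : ℕ) (c p : Fin n → ℂ) (hp : Function.Injective p)
    (μ lam : Fin m → ℂ) (hml : ∀ i j, μ i ≠ lam j)
    (hmp : ∀ i k, μ i ≠ p k) (hlp : ∀ j k, lam j ≠ p k)
    (H : ℂ → ℂ) (hH : ∀ z, H z = ∑ k, c k / (z - p k))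
    (L : Matrix (Fin m) (Fin m) ℂ)
    (hL : ∀ i j, L i j = (H (μ i) - H (lam j)) / (μ i - lam j)) :
    (∀ i j, L i j = -∑ k, c k / ((μ i - p k) * (lam j - p k))) ∧
    L.rank ≤ n := by
  have entry : ∀ i j, L i j = -∑ k, c k / ((μ i - p k) * (lam j - p k)) := by
    intro i j
    have hij : μ i - lam j ≠ 0 := sub_ne_zero.mpr (hml i j)
    rw [hL, hH, hH, div_eq_iff hij, ← Finset.sum_sub_distrib, ← Finset.sum_neg_distrib,
      Finset.sum_mul]
    refine Finset.sum_congr rfl fun k _ => ?_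
    have h1 : μ i - p k ≠ 0 := sub_ne_zero.mpr (hmp i k)
    have h2 : lam j - p k ≠ 0 := sub_ne_zero.mpr (hlp j k)
    field_simp
    ring
  refine ⟨entry, ?_⟩
  have factor : L = (Matrix.of fun i k => -c k / (μ i - p k)) *
      (Matrix.of fun k j => 1 / (lam j - p k) : Matrix (Fin n) (Fin m) ℂ) := by
    ext i j
    rw [entry, Matrix.mul_apply, ← Finset.sum_neg_distrib]
    refine Finset.sum_congr rfl fun k _ => ?_
    simp only [Matrix.of_apply]
    rw [div_mul_div_comm, mul_one, neg_div]
  rw [factor]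
  exact (Matrix.rank_mul_le_left _ _).trans (Matrix.rank_le_width _)
end

section
/- Let H(s) = Σ_{k=1}^n c_k/(s − p_k) be a rational function with complex residues c_k and distinct poles p_k, and let μ₁,…,μ_m, λ₁,…,λ_m ∈ ℂ be points with μᵢ ≠ λⱼ for all i,j and with no μᵢ or λⱼ equal to any pole p_k. Let 𝕃ₛ be the shifted Loewner matrix built from the data vᵢ = H(μᵢ) and wⱼ = H(λⱼ). Then [𝕃ₛ]_{ij} = −Σ_{k=1}^n c_k p_k /((μᵢ − p_k)(λⱼ − p_k)) for all i,j, and consequently the rank of 𝕃ₛ is at most n. -/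
/-- The shifted Loewner matrix built from samples of the rational function
`H(s) = Σₖ cₖ/(s − pₖ)` (with distinct poles, none of which is a sample
point) admits the factorized form
`[𝕃ₛ]_{ij} = −Σₖ cₖpₖ/((μᵢ − pₖ)(λⱼ − pₖ))`, hence has rank at most `n`. -/
theorem shifted_loewner_rank_of_rational
    (n m : ℕ) (c p : Fin n → ℂ) (hp : Function.Injective p)
    (μ lam : Fin m → ℂ) (hml : ∀ i j, μ i ≠ lam j)
    (hmp : ∀ i k, μ i ≠ p k) (hlp : ∀ j k, lam j ≠ p k)
    (H : ℂ → ℂ) (hH : ∀ z, H z = ∑ k, c k / (z - p k))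
    (Ls : Matrix (Fin m) (Fin m) ℂ)
    (hLs : ∀ i j, Ls i j = (μ i * H (μ i) - lam j * H (lam j)) / (μ i - lam j)) :
    (∀ i j, Ls i j = -∑ k, c k * p k / ((μ i - p k) * (lam j - p k))) ∧
    Ls.rank ≤ n := by
  have hform : ∀ i j, Ls i j = -∑ k, c k * p k / ((μ i - p k) * (lam j - p k)) := by
    intro i j
    rw [hLs, hH, hH, div_eq_iff (sub_ne_zero.2 (hml i j)), Finset.mul_sum, Finset.mul_sum,
      ← Finset.sum_sub_distrib, ← Finset.sum_neg_distrib, Finset.sum_mul]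
    refine Finset.sum_congr rfl fun k _ => ?_
    have hμ := sub_ne_zero.2 (hmp i k)
    have hlam := sub_ne_zero.2 (hlp j k)
    field_simp
    ring
  refine ⟨hform, ?_⟩
  let L : Matrix (Fin m) (Fin n) ℂ := Matrix.of fun i k => -(c k * p k) / (μ i - p k)
  let R : Matrix (Fin n) (Fin m) ℂ := Matrix.of fun k j => (lam j - p k)⁻¹
  have hfactor : Ls = L * R := by
    ext i j
    rw [hform, Matrix.mul_apply, ← Finset.sum_neg_distrib]
    refine Finset.sum_congr rfl fun k _ => ?_
    simp only [L, R, Matrix.of_apply]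
    rw [← div_eq_mul_inv, div_div, neg_div]
  rw [hfactor]
  exact (Matrix.rank_mul_le_left L R).trans L.rank_le_width
end
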